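/- Let q ∈ ℝ^d, K₁, V₁ ∈ ℝ^{N₁×d} and K₂, V₂ ∈ ℝ^{N₂×d}. Write [s₁ᵀ, s₂ᵀ] = softmax(qᵀ[K₁; K₂]ᵀ) for the softmax of the concatenated logit vector (qᵀK₁ᵀ, qᵀK₂ᵀ) ∈ ℝ^{N₁+N₂}, with s₁ ∈ ℝ^{N₁} and s₂ ∈ ℝ^{N₂}, and write s̃₁ᵀ = softmax(qᵀK₁ᵀ) ∈ ℝ^{N₁}. Then ‖s̃₁ᵀV₁ − (s₁ᵀV₁ + s₂ᵀV₂)‖₂ ≤ 2‖s₂‖₁ · max{‖V₁‖_{2,∞}, ‖V₂‖_{2,∞}}. -/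

import Mathlib

open scoped BigOperators
open Matrix

/-- The softmax map on `ℝ^d`: the `i`-th entry is `exp (x i) / ∑ j, exp (x j)`. -/
noncomputable def softmax {d : ℕ} (x : Fin d → ℝ) : Fin d → ℝ :=
  fun i => Real.exp (x i) / ∑ j, Real.exp (x j)

/-- The ℓ¹ norm on `ℝ^d`. -/
noncomputable def l1norm {d : ℕ} (x : Fin d → ℝ) : ℝ := ∑ i, |x i|

/-- The Euclidean (ℓ²) norm on `ℝ^d`. -/
noncomputable def l2norm {d : ℕ} (x : Fin d → ℝ) : ℝ := Real.sqrt (∑ i, x i ^ 2)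

/-- The ℓ_{2,∞} norm of a matrix: the maximum ℓ² norm of its rows. -/
noncomputable def norm2inf {N d : ℕ} (X : Matrix (Fin N) (Fin d) ℝ) : ℝ :=
  ⨆ i, l2norm (X i)

theorem l2norm_eq_norm_toLp {d : ℕ} (x : Fin d → ℝ) : l2norm x = ‖WithLp.toLp 2 x‖ := by
  simp [l2norm, EuclideanSpace.norm_eq]

theorem l2norm_sub_le {d : ℕ} (x y : Fin d → ℝ) : l2norm (x - y) ≤ l2norm x + l2norm y := by
  simpa only [l2norm_eq_norm_toLp, WithLp.toLp_sub] using norm_sub_le _ _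

theorem l1norm_nonneg {d : ℕ} (x : Fin d → ℝ) : 0 ≤ l1norm x :=
  Finset.sum_nonneg fun _ _ => abs_nonneg _

theorem l1norm_smul {d : ℕ} (c : ℝ) (x : Fin d → ℝ) : l1norm (c • x) = |c| * l1norm x := by
  simp [l1norm, abs_mul, Finset.mul_sum]

theorem l2norm_row_le_norm2inf {N d : ℕ} (X : Matrix (Fin N) (Fin d) ℝ) (i : Fin N) :
    l2norm (X i) ≤ norm2inf X :=
  le_ciSup (f := fun i => l2norm (X i)) (Set.finite_range _).bddAbove i

theorem l2norm_vecMul_le {N d : ℕ} (w : Fin N → ℝ) (X : Matrix (Fin N) (Fin d) ℝ) :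
    l2norm (w ᵥ* X) ≤ l1norm w * norm2inf X := by
  have h : WithLp.toLp 2 (w ᵥ* X) = ∑ i, w i • WithLp.toLp 2 (X i) := by
    ext j
    simp [vecMul, dotProduct]
  rw [l2norm_eq_norm_toLp, h, l1norm, Finset.sum_mul]
  refine norm_sum_le_of_le _ fun i _ => ?_
  rw [norm_smul, Real.norm_eq_abs, ← l2norm_eq_norm_toLp]
  exact mul_le_mul_of_nonneg_left (l2norm_row_le_norm2inf X i) (abs_nonneg _)

theorem sum_exp_pos {d : ℕ} (hd : 0 < d) (x : Fin d → ℝ) : 0 < ∑ j, Real.exp (x j) :=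
  Finset.sum_pos (fun _ _ => Real.exp_pos _) ⟨⟨0, hd⟩, Finset.mem_univ _⟩

theorem softmax_nonneg {d : ℕ} (x : Fin d → ℝ) (i : Fin d) : 0 ≤ softmax x i :=
  div_nonneg (Real.exp_pos _).le (Finset.sum_nonneg fun _ _ => (Real.exp_pos _).le)

theorem l1norm_softmax {d : ℕ} (hd : 0 < d) (x : Fin d → ℝ) : l1norm (softmax x) = 1 := by
  simp only [l1norm, abs_of_nonneg (softmax_nonneg x _)]
  simp only [softmax]
  rw [← Finset.sum_div, div_self (sum_exp_pos hd x).ne']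

/-- The first block of a softmax is the softmax of the first block of logits, scaled by the mass
not carried by the second block. -/
theorem softmax_append_castAdd {m n : ℕ} (hm : 0 < m) (x : Fin m → ℝ) (y : Fin n → ℝ) :
    (fun i => softmax (Fin.append x y) (Fin.castAdd n i)) =
      (1 - l1norm fun j => softmax (Fin.append x y) (Fin.natAdd m j)) • softmax x := by
  have hx := sum_exp_pos hm x
  have hy : 0 ≤ ∑ j, Real.exp (y j) := Finset.sum_nonneg fun _ _ => (Real.exp_pos _).le
  have hxy : ∑ j, Real.exp (x j) + ∑ j, Real.exp (y j) ≠ 0 := by positivity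
  funext i
  simp only [l1norm, abs_of_nonneg (softmax_nonneg _ _), Pi.smul_apply, smul_eq_mul]
  simp only [softmax, Fin.sum_univ_add, Fin.append_left, Fin.append_right]
  rw [← Finset.sum_div]
  field_simp
  ring

/-- With `[s₁ᵀ, s₂ᵀ] = softmax(qᵀ[K₁; K₂]ᵀ)` and `s̃₁ᵀ = softmax(qᵀK₁ᵀ)`,
`‖s̃₁ᵀV₁ − (s₁ᵀV₁ + s₂ᵀV₂)‖₂ ≤ 2 ‖s₂‖₁ max{‖V₁‖_{2,∞}, ‖V₂‖_{2,∞}}`. -/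
theorem softmax_block_attention_error {d N₁ N₂ : ℕ} (hN₁ : 0 < N₁) (q : Fin d → ℝ)
    (K₁ V₁ : Matrix (Fin N₁) (Fin d) ℝ) (K₂ V₂ : Matrix (Fin N₂) (Fin d) ℝ)
    (sFull : Fin (N₁ + N₂) → ℝ) (s₁ : Fin N₁ → ℝ) (s₂ : Fin N₂ → ℝ) (s₁' : Fin N₁ → ℝ)
    (hFull : sFull = softmax (Fin.append (fun i => q ⬝ᵥ K₁ i) (fun j => q ⬝ᵥ K₂ j)))
    (hs₁ : s₁ = fun i => sFull (Fin.castAdd N₂ i))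
    (hs₂ : s₂ = fun j => sFull (Fin.natAdd N₁ j))
    (hs₁' : s₁' = softmax (fun i => q ⬝ᵥ K₁ i)) :
    l2norm (s₁' ᵥ* V₁ - (s₁ ᵥ* V₁ + s₂ ᵥ* V₂)) ≤
      2 * l1norm s₂ * max (norm2inf V₁) (norm2inf V₂) := by
  subst hs₁' hs₁ hs₂ hFull
  rw [softmax_append_castAdd hN₁]
  set s := softmax fun i => q ⬝ᵥ K₁ i with hs
  set t := fun j => softmax (Fin.append (fun i => q ⬝ᵥ K₁ i) (fun j => q ⬝ᵥ K₂ j))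
    (Fin.natAdd N₁ j)
  have hsplit : s ᵥ* V₁ - (((1 - l1norm t) • s) ᵥ* V₁ + t ᵥ* V₂) =
      (l1norm t • s) ᵥ* V₁ - t ᵥ* V₂ := by
    simp only [sub_smul, one_smul, sub_vecMul]
    abel
  have ht := l1norm_nonneg t
  calc l2norm (s ᵥ* V₁ - (((1 - l1norm t) • s) ᵥ* V₁ + t ᵥ* V₂))
      ≤ l2norm ((l1norm t • s) ᵥ* V₁) + l2norm (t ᵥ* V₂) := hsplit ▸ l2norm_sub_le _ _
    _ ≤ l1norm (l1norm t • s) * norm2inf V₁ + l1norm t * norm2inf V₂ :=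
        add_le_add (l2norm_vecMul_le _ _) (l2norm_vecMul_le _ _)
    _ = l1norm t * norm2inf V₁ + l1norm t * norm2inf V₂ := by
        rw [l1norm_smul, abs_of_nonneg ht, hs, l1norm_softmax hN₁, mul_one]
    _ ≤ l1norm t * max (norm2inf V₁) (norm2inf V₂) +
          l1norm t * max (norm2inf V₁) (norm2inf V₂) := by
        gcongr
        exacts [le_max_left _ _, le_max_right _ _]
    _ = 2 * l1norm t * max (norm2inf V₁) (norm2inf V₂) := by ring
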